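/- Let (H^(0),...,H^(K)) be the reversible Gaussian Markov chain where adjacent pairs are (1-eps)-correlated. For each i let S_solve(i) and S_stab(i) be events, where S_solve(i) depends only on H^(i) (via a fixed measurable set S: S_solve(i) = {H^(i) in S}), and S_stab(i) depends only on the pair (H^(i), H^(i+1)) via a fixed symmetric measurable relation. Let p_solve = P[S_solve(0)] and p_unstable = 1 - P[S_stab(0)]. Then P[ all S_solve(i), 0<=i<=K, and all S_stab(i), 0<=i<=K-1, hold ] >= max(p_solve^2 - p_unstable, 0)^{2K}. -/

import Mathlib

open MeasureTheory ProbabilityTheory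

/-- The standard Gaussian measure on `ℝ^d`. -/
noncomputable def stdGaussianPi (d : ℕ) : Measure (Fin d → ℝ) :=
  Measure.pi fun _ => gaussianReal 0 1

/-- The Ornstein–Uhlenbeck Markov chain of standard Gaussian vectors in `ℝ^d`, in closed
form: adjacent elements are `p`-correlated and `H i, H j` are `p^{|i-j|}`-correlated. -/
noncomputable def ouChain (d K : ℕ) (p : ℝ) (ω : Fin (K + 1) → Fin d → ℝ) (i : ℕ) :
    Fin d → ℝ := fun t =>
  p ^ i * ω 0 t +
    ∑ j : Fin (K + 1),
      if 0 < (j : ℕ) ∧ (j : ℕ) ≤ i then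
        p ^ (i - (j : ℕ)) * Real.sqrt (1 - p ^ 2) * ω j t
      else 0

open scoped ENNReal

instance isProbabilityMeasure_stdGaussianPi (d : ℕ) : IsProbabilityMeasure (stdGaussianPi d) := by
  unfold stdGaussianPi; infer_instance

instance isGaussian_stdGaussianPi (d : ℕ) : IsGaussian (stdGaussianPi d) := by
  have h : stdGaussianPi d = (stdGaussian (EuclideanSpace ℝ (Fin d))).map
      (EuclideanSpace.equiv (Fin d) ℝ) := by
    rw [← map_pi_eq_stdGaussian, Measure.map_map (by fun_prop) (by fun_prop)]
    exact Measure.map_id.symm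
  rw [h]
  infer_instance

lemma integral_id_stdGaussianPi (d : ℕ) : (stdGaussianPi d)[id] = 0 := by
  ext i
  have h : Integrable id (stdGaussianPi d) := IsGaussian.integrable_id
  have h1 := (ContinuousLinearMap.proj (R := ℝ) (φ := fun _ : Fin d => ℝ) i).integral_comp_comm h
  simp only [ContinuousLinearMap.proj_apply, id_eq] at h1
  simp only [id_eq]
  rw [← h1]
  have h2 := (measurePreserving_eval (fun _ : Fin d => gaussianReal 0 1) i)
  have h3 := integral_map (μ := stdGaussianPi d) (φ := Function.eval i) (f := fun x : ℝ => x)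
    (measurable_pi_apply i).aemeasurable (by fun_prop)
  simp only [Function.eval] at h3
  rw [← h3]
  change ∫ y, y ∂((Measure.pi fun _ : Fin d => gaussianReal 0 1).map (Function.eval i)) = 0
  rw [h2.map_eq]
  simp

lemma measurePreserving_rotation_stdGaussianPi (d : ℕ) (θ : ℝ) :
    MeasurePreserving (fun x : (Fin d → ℝ) × (Fin d → ℝ) =>
      (Real.cos θ • x.1 + Real.sin θ • x.2, -Real.sin θ • x.1 + Real.cos θ • x.2))
      ((stdGaussianPi d).prod (stdGaussianPi d)) ((stdGaussianPi d).prod (stdGaussianPi d)) :=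
  ⟨by fun_prop, IsGaussian.map_rotation_eq_self (integral_id_stdGaussianPi d) θ⟩

lemma measurePreserving_neg_stdGaussianPi (d : ℕ) :
    MeasurePreserving (fun x : Fin d → ℝ => -x) (stdGaussianPi d) (stdGaussianPi d) := by
  have h := (measurePreserving_fst (μ := stdGaussianPi d) (ν := stdGaussianPi d)).comp
    (measurePreserving_rotation_stdGaussianPi d Real.pi)
  refine ⟨by fun_prop, ?_⟩
  have h' := h.map_eq
  have e : (Prod.fst ∘ fun x : (Fin d → ℝ) × (Fin d → ℝ) =>
      (Real.cos Real.pi • x.1 + Real.sin Real.pi • x.2,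
        -Real.sin Real.pi • x.1 + Real.cos Real.pi • x.2)) = (fun x => -x) ∘ Prod.fst := by
    ext; simp
  rw [e, ← Measure.map_map (by fun_prop) (by fun_prop), measurePreserving_fst.map_eq] at h'
  exact h'

/-- One step of the Ornstein–Uhlenbeck chain with correlation `p`, driven by the noise `z`. -/
noncomputable def ouStep {d : ℕ} (p : ℝ) (x z : Fin d → ℝ) : Fin d → ℝ :=
  p • x + Real.sqrt (1 - p ^ 2) • z

@[fun_prop]
lemma Measurable.ouStep {α : Type*} [MeasurableSpace α] {d : ℕ} {p : ℝ} {f g : α → Fin d → ℝ}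
    (hf : Measurable f) (hg : Measurable g) : Measurable fun a => ouStep p (f a) (g a) := by
  unfold _root_.ouStep; fun_prop

lemma lintegral_ouStep_comm {d : ℕ} {p : ℝ} (hp : -1 ≤ p) (hp' : p ≤ 1)
    {F : (Fin d → ℝ) × (Fin d → ℝ) → ℝ≥0∞} (hF : Measurable F) :
    ∫⁻ x, ∫⁻ z, F (x, ouStep p x z) ∂stdGaussianPi d ∂stdGaussianPi d =
      ∫⁻ x, ∫⁻ z, F (ouStep p x z, x) ∂stdGaussianPi d ∂stdGaussianPi d := by
  have hc : Real.cos (Real.arccos p) = p := Real.cos_arccos hp hp'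
  have hs : Real.sin (Real.arccos p) = Real.sqrt (1 - p ^ 2) := Real.sin_arccos p
  have hsq : Real.sqrt (1 - p ^ 2) ^ 2 = 1 - p ^ 2 := Real.sq_sqrt (by nlinarith)
  have rot := measurePreserving_rotation_stdGaussianPi d (Real.arccos p)
  rw [hc, hs] at rot
  rw [← lintegral_prod (fun q : (Fin d → ℝ) × (Fin d → ℝ) => F (ouStep p q.1 q.2, q.1))
    (by fun_prop), ← lintegral_prod
    (fun q : (Fin d → ℝ) × (Fin d → ℝ) => F (q.1, ouStep p q.1 q.2)) (by fun_prop)]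
  have neg := (MeasurePreserving.id (stdGaussianPi d)).prod (measurePreserving_neg_stdGaussianPi d)
  rw [← (neg.comp rot).lintegral_comp
    (f := fun q : (Fin d → ℝ) × (Fin d → ℝ) => F (ouStep p q.1 q.2, q.1)) (by fun_prop)]
  refine lintegral_congr fun q => ?_
  simp only [Function.comp, Prod.map, id]
  congr 2
  ext i
  simp only [ouStep, Pi.add_apply, Pi.smul_apply, Pi.neg_apply, smul_eq_mul]
  linear_combination (-(q.1 i)) * hsq

lemma lintegral_ouStep_ouStep {d : ℕ} {r : ℝ} (hr : 0 ≤ r) (hr' : r < 1)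
    {g : (Fin d → ℝ) → ℝ≥0∞} (hg : Measurable g) (x : Fin d → ℝ) :
    ∫⁻ z, ∫⁻ w, g (ouStep r (ouStep r x z) w) ∂stdGaussianPi d ∂stdGaussianPi d =
      ∫⁻ z, g (ouStep (r ^ 2) x z) ∂stdGaussianPi d := by
  set c := r / Real.sqrt (1 + r ^ 2) with hc_def
  have hpos : 0 < Real.sqrt (1 + r ^ 2) := Real.sqrt_pos.2 (by positivity)
  have hone : Real.sqrt (1 + r ^ 2) ^ 2 = 1 + r ^ 2 := Real.sq_sqrt (by positivity)
  have hc0 : 0 ≤ c := by positivity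
  have hc1 : c ≤ 1 := by
    rw [hc_def, div_le_one hpos]
    exact Real.le_sqrt_of_sq_le (by linarith)
  have hc : Real.cos (Real.arccos c) = c := Real.cos_arccos (by linarith) hc1
  have hs : Real.sin (Real.arccos c) = 1 / Real.sqrt (1 + r ^ 2) := by
    rw [Real.sin_arccos, Real.sqrt_eq_iff_mul_self_eq (by nlinarith) (by positivity), hc_def]
    field_simp
    rw [hone]; ring
  have hfac : Real.sqrt (1 - (r ^ 2) ^ 2) = Real.sqrt (1 - r ^ 2) * Real.sqrt (1 + r ^ 2) := by
    rw [← Real.sqrt_mul (by nlinarith)]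
    congr 1; ring
  have rot := measurePreserving_fst.comp
    (measurePreserving_rotation_stdGaussianPi d (Real.arccos c))
  rw [hc, hs] at rot
  rw [← rot.lintegral_comp (f := fun z => g (ouStep (r ^ 2) x z)) (by fun_prop),
    ← lintegral_prod (fun q : (Fin d → ℝ) × (Fin d → ℝ) =>
      g (ouStep r (ouStep r x q.1) q.2)) (by fun_prop)]
  refine lintegral_congr fun q => ?_
  congr 1
  ext i
  simp only [ouStep, Function.comp, Pi.add_apply, Pi.smul_apply, smul_eq_mul, hfac, hc_def]
  field_simp
  ring

lemma sq_lintegral_le_lintegral_sq {α : Type*} [MeasurableSpace α] {μ : Measure α}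
    [IsProbabilityMeasure μ] {f : α → ℝ≥0∞} (hf : Measurable f) :
    (∫⁻ x, f x ∂μ) ^ 2 ≤ ∫⁻ x, f x ^ 2 ∂μ := by
  have h := ENNReal.lintegral_mul_le_Lp_mul_Lq μ Real.HolderConjugate.two_two
    hf.aemeasurable (aemeasurable_const (b := (1 : ℝ≥0∞)))
  simp only [Pi.mul_apply, mul_one, lintegral_const, measure_univ, ENNReal.rpow_two, one_pow,
    ENNReal.one_rpow] at h
  calc (∫⁻ x, f x ∂μ) ^ 2 ≤ ((∫⁻ x, f x ^ 2 ∂μ) ^ (1 / 2 : ℝ)) ^ 2 := by gcongr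
    _ = ∫⁻ x, f x ^ 2 ∂μ := by
      rw [← ENNReal.rpow_two, ← ENNReal.rpow_mul]; norm_num

lemma sq_measure_le_lintegral_ouStep {d : ℕ} {p : ℝ} (hp : 0 ≤ p) (hp' : p < 1)
    {S : Set (Fin d → ℝ)} (hS : MeasurableSet S) :
    stdGaussianPi d S ^ 2 ≤ ∫⁻ x, ∫⁻ z, S.indicator 1 x * S.indicator 1 (ouStep p x z)
      ∂stdGaussianPi d ∂stdGaussianPi d := by
  obtain ⟨r, hr, hr', rfl⟩ : ∃ r : ℝ, 0 ≤ r ∧ r < 1 ∧ r ^ 2 = p :=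
    ⟨Real.sqrt p, Real.sqrt_nonneg p, by rw [Real.sqrt_lt' one_pos]; simpa,
      Real.sq_sqrt hp⟩
  have hf : Measurable (S.indicator (1 : (Fin d → ℝ) → ℝ≥0∞)) := measurable_one.indicator hS
  have hg : Measurable fun x => ∫⁻ z, S.indicator (1 : (Fin d → ℝ) → ℝ≥0∞) (ouStep r x z)
      ∂stdGaussianPi d :=
    Measurable.lintegral_prod_right' (f := fun q : (Fin d → ℝ) × (Fin d → ℝ) =>
      S.indicator (1 : (Fin d → ℝ) → ℝ≥0∞) (ouStep r q.1 q.2)) (by fun_prop)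
  have hmean : stdGaussianPi d S = ∫⁻ x, ∫⁻ z, S.indicator 1 (ouStep r x z)
      ∂stdGaussianPi d ∂stdGaussianPi d := by
    have h := lintegral_ouStep_comm (d := d) (p := r) (by linarith) hr'.le
      (F := fun q => S.indicator 1 q.1) (by fun_prop)
    simp only [lintegral_const, measure_univ, mul_one] at h
    rw [← h, lintegral_indicator_one hS]
  rw [hmean]
  refine (sq_lintegral_le_lintegral_sq hg).trans (le_of_eq ?_)
  set G := fun x => ∫⁻ z, S.indicator (1 : (Fin d → ℝ) → ℝ≥0∞) (ouStep r x z) ∂stdGaussianPi d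
    with hG
  calc ∫⁻ x, G x ^ 2 ∂stdGaussianPi d
      = ∫⁻ x, ∫⁻ z, G x * S.indicator 1 (ouStep r x z) ∂stdGaussianPi d ∂stdGaussianPi d := by
        refine lintegral_congr fun x => ?_
        rw [lintegral_const_mul _ (by fun_prop), sq]
    _ = ∫⁻ x, ∫⁻ z, G (ouStep r x z) * S.indicator 1 x ∂stdGaussianPi d ∂stdGaussianPi d :=
        lintegral_ouStep_comm (by linarith) hr'.le
          (F := fun q => G q.1 * S.indicator 1 q.2) (by fun_prop)
    _ = _ := by
        refine lintegral_congr fun x => ?_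
        rw [lintegral_mul_const _ (by fun_prop), lintegral_const_mul _ (by fun_prop), mul_comm,
          ← lintegral_ouStep_ouStep hr hr' hf]

/-- The Ornstein–Uhlenbeck transition operator restricted to transitions in `R`. -/
noncomputable def ouTransfer {d : ℕ} (p : ℝ) (R : Set ((Fin d → ℝ) × (Fin d → ℝ)))
    (g : (Fin d → ℝ) → ℝ≥0∞) (x : Fin d → ℝ) : ℝ≥0∞ :=
  ∫⁻ z, R.indicator 1 (x, ouStep p x z) * g (ouStep p x z) ∂stdGaussianPi d

section Transfer

variable {d : ℕ} {p : ℝ} {R : Set ((Fin d → ℝ) × (Fin d → ℝ))}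

lemma measurable_ouTransfer (hR : MeasurableSet R) {g : (Fin d → ℝ) → ℝ≥0∞} (hg : Measurable g) :
    Measurable (ouTransfer p R g) := by
  have hw : Measurable (R.indicator (1 : (Fin d → ℝ) × (Fin d → ℝ) → ℝ≥0∞)) :=
    measurable_one.indicator hR
  exact Measurable.lintegral_prod_right' (f := fun q : (Fin d → ℝ) × (Fin d → ℝ) =>
    R.indicator (1 : (Fin d → ℝ) × (Fin d → ℝ) → ℝ≥0∞) (q.1, ouStep p q.1 q.2) *
      g (ouStep p q.1 q.2)) (by fun_prop)

lemma measurable_ouTransfer_iterate (hR : MeasurableSet R) (n : ℕ) :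
    Measurable ((ouTransfer p R)^[n] 1) := by
  induction n with
  | zero => exact measurable_one
  | succ n ih => rw [Function.iterate_succ_apply']; exact measurable_ouTransfer hR ih

lemma monotone_ouTransfer : Monotone (ouTransfer p R) := by
  intro f g h x
  exact lintegral_mono fun z => by gcongr; exact h _

lemma ouTransfer_one_le : ouTransfer p R 1 ≤ 1 := by
  intro x
  calc ouTransfer p R 1 x ≤ ∫⁻ _, 1 ∂stdGaussianPi d := by
        refine lintegral_mono fun z => ?_
        simpa using Set.indicator_le_self R (1 : (Fin d → ℝ) × (Fin d → ℝ) → ℝ≥0∞) _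
    _ = 1 := by simp

lemma antitone_lintegral_ouTransfer_iterate :
    Antitone fun n => ∫⁻ x, (ouTransfer p R)^[n] 1 x ∂stdGaussianPi d :=
  fun _ _ h => lintegral_mono
    (monotone_ouTransfer.antitone_iterate_of_map_le ouTransfer_one_le h)

lemma lintegral_mul_ouTransfer (hp : -1 ≤ p) (hp' : p ≤ 1) (hR : MeasurableSet R)
    (hRsymm : ∀ a b, (a, b) ∈ R ↔ (b, a) ∈ R) {f g : (Fin d → ℝ) → ℝ≥0∞}
    (hf : Measurable f) (hg : Measurable g) :
    ∫⁻ x, f x * ouTransfer p R g x ∂stdGaussianPi d =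
      ∫⁻ x, ouTransfer p R f x * g x ∂stdGaussianPi d := by
  have hw : Measurable (R.indicator (1 : (Fin d → ℝ) × (Fin d → ℝ) → ℝ≥0∞)) :=
    measurable_one.indicator hR
  calc ∫⁻ x, f x * ouTransfer p R g x ∂stdGaussianPi d
      = ∫⁻ x, ∫⁻ z, f x * (R.indicator 1 (x, ouStep p x z) * g (ouStep p x z))
          ∂stdGaussianPi d ∂stdGaussianPi d :=
        lintegral_congr fun x => (lintegral_const_mul _ (by fun_prop)).symm
    _ = ∫⁻ x, ∫⁻ z, f (ouStep p x z) * (R.indicator 1 (ouStep p x z, x) * g x)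
          ∂stdGaussianPi d ∂stdGaussianPi d :=
        lintegral_ouStep_comm hp hp'
          (F := fun q => f q.1 * (R.indicator 1 q * g q.2)) (by fun_prop)
    _ = _ := by
        refine lintegral_congr fun x => ?_
        rw [ouTransfer, ← lintegral_mul_const _ (by fun_prop)]
        refine lintegral_congr fun z => ?_
        have : R.indicator (1 : (Fin d → ℝ) × (Fin d → ℝ) → ℝ≥0∞) (ouStep p x z, x) =
            R.indicator 1 (x, ouStep p x z) := by
          by_cases h : (x, ouStep p x z) ∈ R
          · simp [h, (hRsymm _ _).1 h]
          · simp [h, mt (hRsymm _ _).2 h]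
        rw [this]; ring

lemma lintegral_ouTransfer_iterate_mul (hp : -1 ≤ p) (hp' : p ≤ 1) (hR : MeasurableSet R)
    (hRsymm : ∀ a b, (a, b) ∈ R ↔ (b, a) ∈ R) (m n : ℕ) :
    ∫⁻ x, (ouTransfer p R)^[m] 1 x * (ouTransfer p R)^[n] 1 x ∂stdGaussianPi d =
      ∫⁻ x, (ouTransfer p R)^[m + n] 1 x ∂stdGaussianPi d := by
  induction m generalizing n with
  | zero => simp
  | succ m ih =>
    rw [Function.iterate_succ_apply', ← lintegral_mul_ouTransfer hp hp' hR hRsymm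
      (measurable_ouTransfer_iterate hR m) (measurable_ouTransfer_iterate hR n),
      ← Function.iterate_succ_apply' (ouTransfer p R) n, ih, Nat.succ_add, Nat.add_succ]

lemma pow_le_lintegral_ouTransfer_iterate (hp : -1 ≤ p) (hp' : p ≤ 1) (hR : MeasurableSet R)
    (hRsymm : ∀ a b, (a, b) ∈ R ↔ (b, a) ∈ R) (j : ℕ) :
    (∫⁻ x, ouTransfer p R 1 x ∂stdGaussianPi d) ^ 2 ^ j ≤
      ∫⁻ x, (ouTransfer p R)^[2 ^ j] 1 x ∂stdGaussianPi d := by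
  induction j with
  | zero => simp
  | succ j ih =>
    calc _ = ((∫⁻ x, ouTransfer p R 1 x ∂stdGaussianPi d) ^ 2 ^ j) ^ 2 := by
          rw [← pow_mul, pow_succ]
      _ ≤ (∫⁻ x, (ouTransfer p R)^[2 ^ j] 1 x ∂stdGaussianPi d) ^ 2 := by gcongr
      _ ≤ ∫⁻ x, (ouTransfer p R)^[2 ^ j] 1 x ^ 2 ∂stdGaussianPi d :=
          sq_lintegral_le_lintegral_sq (measurable_ouTransfer_iterate hR _)
      _ = _ := by
          simp_rw [sq]
          rw [lintegral_ouTransfer_iterate_mul hp hp' hR hRsymm, pow_succ, mul_two]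

lemma pow_two_mul_le_lintegral_ouTransfer_iterate (hp : -1 ≤ p) (hp' : p ≤ 1)
    (hR : MeasurableSet R) (hRsymm : ∀ a b, (a, b) ∈ R ↔ (b, a) ∈ R) {n : ℕ} (hn : 1 ≤ n) :
    (∫⁻ x, ouTransfer p R 1 x ∂stdGaussianPi d) ^ (2 * n) ≤
      ∫⁻ x, (ouTransfer p R)^[n] 1 x ∂stdGaussianPi d := by
  have hle : ∫⁻ x, ouTransfer p R 1 x ∂stdGaussianPi d ≤ 1 :=
    (lintegral_mono ouTransfer_one_le).trans (by simp)
  have h1 : 2 ^ (Nat.log 2 n + 1) ≤ 2 * n := by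
    rw [pow_succ, mul_comm]
    exact Nat.mul_le_mul_left 2 (Nat.pow_log_le_self 2 (by omega))
  have h2 : n ≤ 2 ^ (Nat.log 2 n + 1) := (Nat.lt_pow_succ_log_self (by norm_num) n).le
  calc _ ≤ _ := pow_le_pow_right_of_le_one' hle h1
    _ ≤ _ := pow_le_lintegral_ouTransfer_iterate hp hp' hR hRsymm _
    _ ≤ _ := antitone_lintegral_ouTransfer_iterate h2

lemma sq_measure_le_lintegral_ouTransfer_add (hp : 0 ≤ p) (hp' : p < 1) (hR : MeasurableSet R)
    {S : Set (Fin d → ℝ)} (hS : MeasurableSet S) :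
    stdGaussianPi d S ^ 2 ≤ ∫⁻ x, ouTransfer p (R ∩ S ×ˢ S) 1 x ∂stdGaussianPi d +
      ∫⁻ x, ouTransfer p Rᶜ 1 x ∂stdGaussianPi d := by
  have hw : Measurable (Rᶜ.indicator (1 : (Fin d → ℝ) × (Fin d → ℝ) → ℝ≥0∞)) :=
    measurable_one.indicator hR.compl
  refine (sq_measure_le_lintegral_ouStep hp hp' hS).trans ?_
  rw [← lintegral_add_right _ (measurable_ouTransfer hR.compl measurable_one)]
  refine lintegral_mono fun x => ?_
  simp only [ouTransfer]
  rw [← lintegral_add_right _ (by simpa using by fun_prop)]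
  refine lintegral_mono fun z => ?_
  by_cases h1 : x ∈ S <;> by_cases h2 : ouStep p x z ∈ S <;>
    by_cases h3 : (x, ouStep p x z) ∈ R <;> simp [h1, h2, h3]

end Transfer

section Chain

variable {d K : ℕ} {p : ℝ}

lemma ouChain_zero (ω : Fin (K + 1) → Fin d → ℝ) : ouChain d K p ω 0 = ω 0 := by
  ext t
  simp only [ouChain, pow_zero, one_mul, add_eq_left]
  exact Finset.sum_eq_zero fun j _ => if_neg (by omega)

lemma ouChain_succ (ω : Fin (K + 1) → Fin d → ℝ) {i : ℕ} (hi : i < K) :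
    ouChain d K p ω (i + 1) = ouStep p (ouChain d K p ω i) (ω ⟨i + 1, by omega⟩) := by
  ext t
  simp only [ouChain, ouStep, Pi.add_apply, Pi.smul_apply, smul_eq_mul, mul_add, Finset.mul_sum]
  rw [pow_succ', mul_assoc, add_assoc]
  congr 1
  rw [← Finset.sum_erase_add _ _ (Finset.mem_univ (⟨i + 1, by omega⟩ : Fin (K + 1))),
    ← Finset.sum_erase_add (a := (⟨i + 1, by omega⟩ : Fin (K + 1))) _ _ (Finset.mem_univ _)]
  simp only [add_assoc]
  congr 1
  · refine Finset.sum_congr rfl fun j hj => ?_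
    have hne : (j : ℕ) ≠ i + 1 := fun h => (Finset.mem_erase.1 hj).1 (Fin.ext h)
    by_cases h : 0 < (j : ℕ) ∧ (j : ℕ) ≤ i
    · rw [if_pos h, if_pos ⟨h.1, by omega⟩, Nat.succ_sub h.2, pow_succ']
      ring
    · rw [if_neg h, if_neg (by omega), mul_zero]
  · simp

lemma ouChain_insertNth_last (z : Fin d → ℝ) (ω : Fin (K + 1) → Fin d → ℝ) {i : ℕ} (hi : i ≤ K) :
    ouChain d (K + 1) p (Fin.insertNth (Fin.last (K + 1)) z ω : Fin (K + 1 + 1) → Fin d → ℝ) i =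
      ouChain d K p ω i := by
  rw [Fin.insertNth_last']
  ext t
  simp only [ouChain]
  rw [Fin.sum_univ_castSucc, if_neg (by simp; omega), add_zero]
  simp only [Fin.snoc_castSucc, Fin.val_castSucc]
  rw [← Fin.castSucc_zero, Fin.snoc_castSucc]

@[fun_prop]
lemma measurable_ouChain (i : ℕ) : Measurable fun ω => ouChain d K p ω i := by
  refine measurable_pi_lambda _ fun t => ?_
  simp only [ouChain]
  refine Measurable.add (by fun_prop) (Finset.measurable_sum _ fun j _ => ?_)
  split_ifs <;> fun_prop

lemma lintegral_pi_succ {E : Type*} [MeasurableSpace E] (μ : Measure E) [IsProbabilityMeasure μ]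
    (i : Fin (K + 2)) {F : (Fin (K + 2) → E) → ℝ≥0∞} (hF : Measurable F) :
    ∫⁻ ω, F ω ∂(Measure.pi fun _ : Fin (K + 2) => μ) =
      ∫⁻ ω, ∫⁻ z, F (i.insertNth z ω) ∂μ ∂(Measure.pi fun _ : Fin (K + 1) => μ) := by
  have h := (measurePreserving_piFinSuccAbove (fun _ : Fin (K + 2) => μ) i).symm
  rw [← h.lintegral_comp hF, lintegral_prod_symm'
    (fun a => F ((MeasurableEquiv.piFinSuccAbove (fun _ => E) i).symm a)) (by fun_prop)]
  rfl

lemma lintegral_indicator_ouChain {R : Set ((Fin d → ℝ) × (Fin d → ℝ))} (hR : MeasurableSet R)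
    (K : ℕ) {g : (Fin d → ℝ) → ℝ≥0∞} (hg : Measurable g) :
    ∫⁻ ω, {ω | ∀ i < K, (ouChain d K p ω i, ouChain d K p ω (i + 1)) ∈ R}.indicator
        (fun ω => g (ouChain d K p ω K)) ω ∂(Measure.pi fun _ : Fin (K + 1) => stdGaussianPi d) =
      ∫⁻ x, (ouTransfer p R)^[K] g x ∂stdGaussianPi d := by
  have hmeas (K n : ℕ) : MeasurableSet
      {ω | ∀ i < n, (ouChain d K p ω i, ouChain d K p ω (i + 1)) ∈ R} := by
    simp only [Set.ofPred_forall]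
    exact .iInter fun i => .iInter fun _ => hR.preimage (by fun_prop)
  induction K generalizing g with
  | zero =>
    have h := (measurePreserving_eval (fun _ : Fin (0 + 1) => stdGaussianPi d) 0).lintegral_comp hg
    simpa [ouChain_zero] using h
  | succ K ih =>
    rw [lintegral_pi_succ _ (Fin.last (K + 1)) ((by fun_prop : Measurable _).indicator (hmeas _ _)),
      Function.iterate_succ_apply, ← ih (measurable_ouTransfer hR hg)]
    have hw : Measurable (R.indicator (1 : (Fin d → ℝ) × (Fin d → ℝ) → ℝ≥0∞)) :=
      measurable_one.indicator hR
    refine lintegral_congr fun ω => ?_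
    have hlast (z : Fin d → ℝ) : ouChain d (K + 1) p
        (Fin.insertNth (Fin.last (K + 1)) z ω : Fin (K + 1 + 1) → Fin d → ℝ) (K + 1) =
        ouStep p (ouChain d K p ω K) z := by
      rw [ouChain_succ _ (Nat.lt_succ_self K), ouChain_insertNth_last z ω le_rfl]
      congr 1
      exact Fin.insertNth_apply_same (α := fun _ => Fin d → ℝ) (Fin.last (K + 1)) z ω
    have hmem (z : Fin d → ℝ) : (Fin.insertNth (Fin.last (K + 1)) z ω : Fin (K + 1 + 1) → _) ∈
        {ω | ∀ i < K + 1, (ouChain d (K + 1) p ω i, ouChain d (K + 1) p ω (i + 1)) ∈ R} ↔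
        ω ∈ {ω | ∀ i < K, (ouChain d K p ω i, ouChain d K p ω (i + 1)) ∈ R} ∧
          (ouChain d K p ω K, ouStep p (ouChain d K p ω K) z) ∈ R := by
      simp only [Set.mem_ofPred_eq, Nat.forall_lt_succ_right]
      rw [hlast, ouChain_insertNth_last z ω le_rfl]
      refine and_congr_left fun _ => forall₂_congr fun i hi => ?_
      rw [ouChain_insertNth_last z ω hi.le, ouChain_insertNth_last z ω hi]
    by_cases h : ω ∈ {ω | ∀ i < K, (ouChain d K p ω i, ouChain d K p ω (i + 1)) ∈ R}
    · rw [Set.indicator_of_mem h]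
      refine lintegral_congr fun z => ?_
      by_cases h' : (ouChain d K p ω K, ouStep p (ouChain d K p ω K) z) ∈ R
      · rw [Set.indicator_of_mem ((hmem z).2 ⟨h, h'⟩), Set.indicator_of_mem h', hlast]
        simp
      · rw [Set.indicator_of_notMem fun hz => h' ((hmem z).1 hz).2, Set.indicator_of_notMem h',
          zero_mul]
    · rw [Set.indicator_of_notMem h]
      simp_rw [Set.indicator_of_notMem fun hz => h ((hmem _).1 hz).1]
      simp

lemma measure_ouChain_transitions {R : Set ((Fin d → ℝ) × (Fin d → ℝ))} (hR : MeasurableSet R) :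
    (Measure.pi fun _ : Fin (K + 1) => stdGaussianPi d)
        {ω | ∀ i < K, (ouChain d K p ω i, ouChain d K p ω (i + 1)) ∈ R} =
      ∫⁻ x, (ouTransfer p R)^[K] 1 x ∂stdGaussianPi d := by
  rw [← lintegral_indicator_ouChain hR K measurable_one]
  refine (lintegral_indicator_one ?_).symm
  simp only [Set.ofPred_forall]
  exact .iInter fun i => .iInter fun _ => hR.preimage (by fun_prop)

lemma measure_ouChain_zero {S : Set (Fin d → ℝ)} (hS : MeasurableSet S) :
    (Measure.pi fun _ : Fin (K + 1) => stdGaussianPi d) {ω | ouChain d K p ω 0 ∈ S} =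
      stdGaussianPi d S := by
  simp only [ouChain_zero]
  exact (measurePreserving_eval (fun _ : Fin (K + 1) => stdGaussianPi d) 0).measure_preimage
    hS.nullMeasurableSet

lemma measure_ouChain_zero_one (hK : 1 ≤ K) {R : Set ((Fin d → ℝ) × (Fin d → ℝ))}
    (hR : MeasurableSet R) :
    (Measure.pi fun _ : Fin (K + 1) => stdGaussianPi d)
        {ω | (ouChain d K p ω 0, ouChain d K p ω 1) ∈ R} =
      ∫⁻ x, ouTransfer p R 1 x ∂stdGaussianPi d := by
  have hmeas (K : ℕ) : MeasurableSet {ω | (ouChain d K p ω 0, ouChain d K p ω 1) ∈ R} :=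
    hR.preimage (by fun_prop)
  induction K, hK using Nat.le_induction with
  | base =>
    have h := measure_ouChain_transitions (K := 1) (p := p) hR
    simpa using h
  | succ K hK ih =>
    rw [← ih, ← lintegral_indicator_one (hmeas _), ← lintegral_indicator_one (hmeas _),
      lintegral_pi_succ _ (Fin.last (K + 1)) (measurable_one.indicator (hmeas _))]
    refine lintegral_congr fun ω => ?_
    refine (lintegral_congr fun z => ?_).trans ((lintegral_const _).trans (by
      rw [measure_univ, mul_one]))
    have hmem : (Fin.insertNth (Fin.last (K + 1)) z ω : Fin (K + 1 + 1) → Fin d → ℝ) ∈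
        {ω | (ouChain d (K + 1) p ω 0, ouChain d (K + 1) p ω 1) ∈ R} ↔
        ω ∈ {ω | (ouChain d K p ω 0, ouChain d K p ω 1) ∈ R} := by
      simp only [Set.mem_ofPred_eq]
      rw [ouChain_insertNth_last z ω K.zero_le, ouChain_insertNth_last z ω hK]
    by_cases h : ω ∈ {ω | (ouChain d K p ω 0, ouChain d K p ω 1) ∈ R}
    · rw [Set.indicator_of_mem (hmem.2 h), Set.indicator_of_mem h]
      rfl
    · rw [Set.indicator_of_notMem (mt hmem.1 h), Set.indicator_of_notMem h]

end Chain

/-- Success-and-stability positive correlation along the OU Gaussian chain: with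
`S_solve(i) = {H i ∈ S}` and `S_stab(i) = {(H i, H (i+1)) ∈ R}` for a symmetric measurable
relation `R`, and `p_solve = P[S_solve(0)]`, `p_unstable = 1 - P[S_stab(0)]`, we have
`P[all solve events and all stability events] ≥ max(p_solve² - p_unstable, 0)^(2K)`. -/
theorem stmt_4 (d K : ℕ) (hK : 1 ≤ K) (ε : ℝ) (hε : ε ∈ Set.Ioo (0 : ℝ) 1)
    (S : Set (Fin d → ℝ)) (hS : MeasurableSet S)
    (R : Set ((Fin d → ℝ) × (Fin d → ℝ))) (hR : MeasurableSet R)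
    (hRsymm : ∀ a b, (a, b) ∈ R ↔ (b, a) ∈ R)
    (psolve punstable : ℝ)
    (hps : psolve = ((Measure.pi fun _ : Fin (K + 1) => stdGaussianPi d)
        {ω | ouChain d K (1 - ε) ω 0 ∈ S}).toReal)
    (hpu : punstable = 1 - ((Measure.pi fun _ : Fin (K + 1) => stdGaussianPi d)
        {ω | (ouChain d K (1 - ε) ω 0, ouChain d K (1 - ε) ω 1) ∈ R}).toReal) :
    max (psolve ^ 2 - punstable) 0 ^ (2 * K) ≤
      ((Measure.pi fun _ : Fin (K + 1) => stdGaussianPi d)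
        {ω | (∀ i ≤ K, ouChain d K (1 - ε) ω i ∈ S) ∧
             (∀ i < K, (ouChain d K (1 - ε) ω i, ouChain d K (1 - ε) ω (i + 1)) ∈ R)}).toReal := by
  have hp : 0 ≤ 1 - ε := by linarith [hε.2]
  have hp' : 1 - ε < 1 := by linarith [hε.1]
  have hR' : MeasurableSet (R ∩ S ×ˢ S) := hR.inter (hS.prod hS)
  have hevent : {ω | (∀ i ≤ K, ouChain d K (1 - ε) ω i ∈ S) ∧
      (∀ i < K, (ouChain d K (1 - ε) ω i, ouChain d K (1 - ε) ω (i + 1)) ∈ R)} =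
      {ω | ∀ i < K, (ouChain d K (1 - ε) ω i, ouChain d K (1 - ε) ω (i + 1)) ∈ R ∩ S ×ˢ S} := by
    ext ω
    simp only [Set.mem_ofPred_eq, Set.mem_inter_iff, Set.mem_prod]
    refine ⟨fun h i hi => ⟨h.2 i hi, h.1 i hi.le, h.1 (i + 1) hi⟩,
      fun h => ⟨fun i hi => ?_, fun i hi => (h i hi).1⟩⟩
    cases i with
    | zero => exact (h 0 hK).2.1
    | succ i => exact (h i hi).2.2
  have hmain := pow_two_mul_le_lintegral_ouTransfer_iterate (d := d) (p := 1 - ε) (by linarith)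
    hp'.le hR' (fun a b => by
      simp only [Set.mem_inter_iff, Set.mem_prod]; rw [hRsymm a b, and_comm (a := a ∈ S)]) hK
  rw [← measure_ouChain_transitions hR', ← measure_ouChain_zero_one hK hR', ← hevent] at hmain
  have hbase := sq_measure_le_lintegral_ouTransfer_add (p := 1 - ε) hp hp' hR hS
  rw [← measure_ouChain_zero (K := K) (p := 1 - ε) hS, ← measure_ouChain_zero_one hK hR',
    ← measure_ouChain_zero_one hK hR.compl] at hbase
  have hbase' := ENNReal.toReal_mono (by finiteness) hbase
  rw [ENNReal.toReal_pow, ENNReal.toReal_add (by finiteness) (by finiteness), ← hps] at hbase'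
  have hcompl : ((Measure.pi fun _ : Fin (K + 1) => stdGaussianPi d)
      {ω | (ouChain d K (1 - ε) ω 0, ouChain d K (1 - ε) ω 1) ∈ Rᶜ}).toReal = punstable := by
    rw [hpu]
    exact probReal_compl_eq_one_sub (hR.preimage (by fun_prop))
  rw [hcompl] at hbase'
  have hmain' := ENNReal.toReal_mono (by finiteness) hmain
  rw [ENNReal.toReal_pow] at hmain'
  refine le_trans ?_ hmain'
  exact pow_le_pow_left₀ (le_max_right _ _)
    (max_le (by linarith) ENNReal.toReal_nonneg) _
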